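/- Let k ≥ 2 and m₁,…,m_k ≥ 4. If ((x₁,q₁),…,(x_k,q_k)) and ((y₁,p₁),…,(y_k,p_k)) are points of S^{m₁} × ⋯ × S^{m_k} and μ > 1 is a real number such that (x₁, x₂, …, x_k, q₁q₂⋯q_k) = μ·(y₁, y₂, …, y_k, p₁p₂⋯p_k) in ℝ^{m₁−3} × ⋯ × ℝ^{m_k−3} × ℍ, then a contradiction follows; equivalently, the vectors (x₁,…,x_k,q₁⋯q_k) and (y₁,…,y_k,p₁⋯p_k) associated to two points of the product of spheres can be positive scalar multiples of each other only with scalar μ = 1. -/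

import Mathlib

open scoped BigOperators

noncomputable section

/-- The sphere `S^{m i} = {(x, q) ∈ ℝ^{m i - 3} × ℍ : |x|² + |q|² = 1}`. -/
abbrev SpSphere (n : ℕ) : Type :=
  {p : EuclideanSpace ℝ (Fin n) × Quaternion ℝ // ‖p.1‖ ^ 2 + ‖p.2‖ ^ 2 = 1}

/-- The norm is multiplicative on ordered products of quaternions. -/
theorem norm_prod_ofFn {k : ℕ} (f : Fin k → Quaternion ℝ) :
    ‖(List.ofFn f).prod‖ = ∏ i, ‖f i‖ := by
  rw [List.norm_prod, List.map_ofFn, List.prod_ofFn]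
  rfl

/-- if the vectors `(x₁,…,x_k,q₁⋯q_k)` and `(y₁,…,y_k,p₁⋯p_k)` associated to two
points of `S^{m₁} × ⋯ × S^{m_k}` satisfy
`(x₁,…,x_k,q₁⋯q_k) = μ • (y₁,…,y_k,p₁⋯p_k)` for a real `μ > 1`, then a contradiction follows;
i.e. such vectors can be positive scalar multiples of each other only with scalar `μ = 1`. -/
theorem stmt7 (k : ℕ) (hk : 2 ≤ k) (m : Fin k → ℕ) (hm : ∀ i, 4 ≤ m i)
    (a b : ∀ i : Fin k, SpSphere (m i - 3)) (μ : ℝ) (hμ : 1 < μ)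
    (hx : ∀ i, (a i).1.1 = μ • (b i).1.1)
    (hq : (List.ofFn fun i => (a i).1.2).prod = μ • (List.ofFn fun i => (b i).1.2).prod) :
    False := by
  have hle : ∀ i, ‖(a i).1.2‖ ≤ ‖(b i).1.2‖ := fun i => by
    have ha := (a i).2
    have hb := (b i).2
    rw [hx i, norm_smul, Real.norm_of_nonneg (by linarith)] at ha
    refine (sq_le_sq₀ (norm_nonneg _) (norm_nonneg _)).mp ?_
    nlinarith [mul_nonneg (sub_nonneg.mpr (one_le_pow₀ hμ.le : 1 ≤ μ ^ 2)) (sq_nonneg ‖(b i).1.1‖)]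
  have hpos : ∀ i, 0 < ‖(b i).1.2‖ := fun i => by
    refine (norm_nonneg _).lt_of_ne fun h => ?_
    have ha := (a i).2
    have hb := (b i).2
    rw [hx i, norm_smul, Real.norm_of_nonneg (by linarith)] at ha
    rw [← h, zero_pow two_ne_zero, add_zero] at hb
    rw [mul_pow, hb] at ha
    nlinarith [sq_nonneg ‖(a i).1.2‖]
  have hn := congrArg norm hq
  rw [norm_smul, Real.norm_of_nonneg (by linarith), norm_prod_ofFn, norm_prod_ofFn] at hn
  have hprod := Finset.prod_le_prod (s := Finset.univ)
    (fun i _ => norm_nonneg (a i).1.2) fun i _ => hle i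
  have hprod_pos := Finset.prod_pos (s := Finset.univ) fun i _ => hpos i
  nlinarith
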